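/- Let V be a bicomplete cartesian monoidal category (the monoidal product is the categorical product × and the monoidal unit is the terminal object 1). Suppose V satisfies (DISJ), namely: (a) for every set S, the functor Φ_S : V^S → V/F(S), sending a family (A_a)_{a∈S} to ∐_{a∈S} A_a with structure map the coproduct of the terminal maps A_a → 1, is an equivalence of categories; (b) the terminal object 1 is indecomposable: whenever 1 ≅ A ⨿ B, either A or B is an initial object of V; (c) V has at least two non-isomorphic objects. Then V is decomposing: (i) coproducts commute with decomposing equalizers; (ii) coproducts in V are disjoint; (iii) the cartesian product preserves decomposing equalizers in each variable. -/

import Mathlib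

open CategoryTheory CategoryTheory.Limits

universe v u

/-- A morphism `f : A ⟶ ∐_{i∈S} A` is *decomposing* if
`(∐_i f) ∘ f = (∐_i ι_i) ∘ f` and `∇ ∘ f = id_A`. -/
def IsDecomposing {C : Type u} [Category.{v} C] {S : Type v} {A : C}
    [HasCoproduct (fun _ : S => A)]
    [HasCoproduct (fun _ : S => ∐ (fun _ : S => A))]
    (f : A ⟶ ∐ (fun _ : S => A)) : Prop :=
  (f ≫ Limits.Sigma.map (fun _ : S => f) =
      f ≫ Limits.Sigma.map (fun i : S => Sigma.ι (fun _ : S => A) i)) ∧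
  f ≫ Sigma.desc (fun _ : S => 𝟙 A) = 𝟙 A

/-- Coproducts commute with decomposing equalizers. -/
def CoprodCommutesWithDecompEqualizers (C : Type u) [Category.{v} C]
    [HasCoproducts.{v} C] : Prop :=
  ∀ (T S : Type v) (A : T → C) (f : ∀ t, A t ⟶ ∐ (fun _ : S => A t)),
    (∀ t, IsDecomposing (f t)) → ∀ (j : S) (E : T → C) (e : ∀ t, E t ⟶ A t)
    (hw : ∀ t, e t ≫ f t = e t ≫ Sigma.ι (fun _ : S => A t) j),
    (∀ t, Nonempty (IsLimit (Fork.ofι (e t) (hw t)))) →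
    Nonempty (IsLimit (Fork.ofι (Limits.Sigma.map e)
      (show Limits.Sigma.map e ≫ Limits.Sigma.map f =
          Limits.Sigma.map e ≫ Limits.Sigma.map (fun t => Sigma.ι (fun _ : S => A t) j) by
        ext t
        simp [reassoc_of% hw t])))

/-- The comparison functor `Φ_S : V^S ⥤ V/F(S)`, where `F(S) = ∐_{a∈S} 1`. -/
noncomputable def Phi (V : Type u) [Category.{v} V] [HasTerminal V] [HasCoproducts.{v} V]
    (S : Type v) : (S → V) ⥤ Over (∐ (fun _ : S => (⊤_ V))) where
  obj A := Over.mk (Limits.Sigma.map fun a => terminal.from (A a))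
  map {A B} φ := Over.homMk (Limits.Sigma.map φ) (by
    dsimp
    rw [Limits.Sigma.map_comp_map]
    congr 1
    funext a
    exact terminal.hom_ext _ _)

lemma nonempty_isLimit_prod_map_left {V : Type u} [Category.{v} V] [HasLimits V]
    {E A B : V} {f g : A ⟶ B} {e : E ⟶ A}
    {hw : e ≫ f = e ≫ g} (hl : IsLimit (Fork.ofι e hw)) (Z : V)
    (w : prod.map (𝟙 Z) e ≫ prod.map (𝟙 Z) f = prod.map (𝟙 Z) e ≫ prod.map (𝟙 Z) g) :
    Nonempty (IsLimit (Fork.ofι (prod.map (𝟙 Z) e) w)) := by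
  refine ⟨Fork.IsLimit.mk' _ fun s => ?_⟩
  have hs : (s.ι ≫ prod.snd) ≫ f = (s.ι ≫ prod.snd) ≫ g := by
    simpa using congrArg (· ≫ prod.snd) s.condition
  have hl' : Fork.IsLimit.lift hl _ hs ≫ e = s.ι ≫ prod.snd := Fork.IsLimit.lift_ι' hl _ hs
  have : Mono e := mono_of_isLimit_fork hl
  have H : prod.lift (s.ι ≫ prod.fst) (Fork.IsLimit.lift hl _ hs) ≫ prod.map (𝟙 Z) e = s.ι := by
    rw [prod.lift_map, hl', Category.comp_id]
    exact (prod.comp_lift _ _ _).symm.trans (by simp)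
  exact ⟨_, H, fun {m} hm => (cancel_mono (prod.map (𝟙 Z) e)).1 (hm.trans H.symm)⟩

lemma nonempty_isLimit_prod_map_right {V : Type u} [Category.{v} V] [HasLimits V]
    {E A B : V} {f g : A ⟶ B} {e : E ⟶ A}
    {hw : e ≫ f = e ≫ g} (hl : IsLimit (Fork.ofι e hw)) (Z : V)
    (w : prod.map e (𝟙 Z) ≫ prod.map f (𝟙 Z) = prod.map e (𝟙 Z) ≫ prod.map g (𝟙 Z)) :
    Nonempty (IsLimit (Fork.ofι (prod.map e (𝟙 Z)) w)) := by
  refine ⟨Fork.IsLimit.mk' _ fun s => ?_⟩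
  have hs : (s.ι ≫ prod.fst) ≫ f = (s.ι ≫ prod.fst) ≫ g := by
    simpa using congrArg (· ≫ prod.fst) s.condition
  have hl' : Fork.IsLimit.lift hl _ hs ≫ e = s.ι ≫ prod.fst := Fork.IsLimit.lift_ι' hl _ hs
  have : Mono e := mono_of_isLimit_fork hl
  have H : prod.lift (Fork.IsLimit.lift hl _ hs) (s.ι ≫ prod.snd) ≫ prod.map e (𝟙 Z) = s.ι := by
    rw [prod.lift_map, hl', Category.comp_id]
    exact (prod.comp_lift _ _ _).symm.trans (by simp)
  exact ⟨_, H, fun {m} hm => (cancel_mono (prod.map e (𝟙 Z))).1 (hm.trans H.symm)⟩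

namespace PhiEquivalence

variable {V : Type u} [Category.{v} V] [HasLimits V] [HasColimits V]

/-- If `Φ_S` is essentially surjective, every morphism to `F(S)` decomposes its source. -/
lemma exists_sigma_iso {S : Type v} (h : (Phi V S).IsEquivalence) {X : V}
    (p : X ⟶ ∐ (fun _ : S => ⊤_ V)) :
    ∃ (Y : S → V) (i : ∐ Y ≅ X),
      i.hom ≫ p = Limits.Sigma.map fun a => terminal.from (Y a) := by
  let i := (Phi V S).objObjPreimageIso (Over.mk p)
  exact ⟨_, (Over.forget _).mapIso i, Over.w i.hom⟩

/-- If `Φ_S` is full, morphisms of coproducts over `F(S)` are coproducts of morphisms. -/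
lemma exists_sigma_map {S : Type v} (h : (Phi V S).IsEquivalence) {A B : S → V}
    (k : ∐ A ⟶ ∐ B)
    (hk : k ≫ (Limits.Sigma.map fun a => terminal.from (B a)) =
      Limits.Sigma.map fun a => terminal.from (A a)) :
    ∃ φ : ∀ a, A a ⟶ B a, k = Limits.Sigma.map φ := by
  let k' : (Phi V S).obj A ⟶ (Phi V S).obj B := Over.homMk k hk
  obtain ⟨φ, hφ⟩ := (Phi V S).map_surjective k'
  exact ⟨φ, congrArg (fun m : (Phi V S).obj A ⟶ (Phi V S).obj B => m.left) hφ.symm⟩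

/-- If `Φ_S` is faithful, a family of morphisms is determined by its coproduct. -/
lemma sigma_map_injective {S : Type v} (h : (Phi V S).IsEquivalence) {A B : S → V}
    {φ ψ : ∀ a, A a ⟶ B a} (e : Limits.Sigma.map φ = Limits.Sigma.map ψ) (a : S) :
    φ a = ψ a := by
  have : (Phi V S).map (X := A) (Y := B) φ = (Phi V S).map (X := A) (Y := B) ψ :=
    Over.OverMorphism.ext e
  exact congrFun ((Phi V S).map_injective this) a

lemma sigma_map_terminal {S : Type v} {A B : S → V} (φ : ∀ a, A a ⟶ B a) :
    Limits.Sigma.map φ ≫ (Limits.Sigma.map fun a => terminal.from (B a)) =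
      Limits.Sigma.map fun a => terminal.from (A a) := by
  ext a
  simp

/-- Initial objects are strict when `Φ_∅` is an equivalence. -/
lemma nonempty_isInitial_of_hom (h : (Phi V PEmpty.{v + 1}).IsEquivalence) {X I : V}
    (hI : IsInitial I) (f : X ⟶ I) : Nonempty (IsInitial X) := by
  obtain ⟨Y, i, -⟩ := exists_sigma_iso h (f ≫ hI.to _)
  have hY : IsInitial (∐ Y) := IsInitial.ofUniqueHom
    (fun Z => Limits.Sigma.desc fun a => a.elim)
    (fun Z m => Limits.Sigma.hom_ext _ _ fun a => a.elim)
  exact ⟨hY.ofIso i⟩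

/-- Coproducts commute with all equalizers when `Φ_T` is an equivalence. -/
lemma nonempty_isLimit_sigma_map {T : Type v} (h : (Phi V T).IsEquivalence)
    {E A B : T → V} (f g : ∀ t, A t ⟶ B t) (e : ∀ t, E t ⟶ A t)
    (hw : ∀ t, e t ≫ f t = e t ≫ g t)
    (hl : ∀ t, Nonempty (IsLimit (Fork.ofι (e t) (hw t))))
    (w : Limits.Sigma.map e ≫ Limits.Sigma.map f = Limits.Sigma.map e ≫ Limits.Sigma.map g) :
    Nonempty (IsLimit (Fork.ofι (Limits.Sigma.map e) w)) := by
  have : Mono (Limits.Sigma.map e) := ⟨fun {X} k l hkl => by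
    obtain ⟨Y, i, hi⟩ := exists_sigma_iso h
      (k ≫ Limits.Sigma.map fun a => terminal.from (E a))
    have hkl' : k ≫ (Limits.Sigma.map fun a => terminal.from (E a)) =
        l ≫ Limits.Sigma.map fun a => terminal.from (E a) := by
      rw [← sigma_map_terminal e, reassoc_of% hkl]
    obtain ⟨φ, hφ⟩ := exists_sigma_map h (i.hom ≫ k) (by rw [Category.assoc, hi])
    obtain ⟨ψ, hψ⟩ := exists_sigma_map h (i.hom ≫ l) (by rw [Category.assoc, ← hkl', hi])
    have he : Limits.Sigma.map (fun t => φ t ≫ e t) =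
        Limits.Sigma.map (fun t => ψ t ≫ e t) := by
      rw [← Limits.Sigma.map_comp_map, ← Limits.Sigma.map_comp_map, ← hφ, ← hψ,
        Category.assoc, Category.assoc, hkl]
    have : φ = ψ := funext fun t =>
      Fork.IsLimit.hom_ext (hl t).some (sigma_map_injective h he t)
    rw [← cancel_epi i.hom, hφ, hψ, this]⟩
  refine ⟨Fork.IsLimit.mk' _ fun s => ?_⟩
  have H : ∃ l, l ≫ Limits.Sigma.map e = s.ι := by
    obtain ⟨Y, i, hi⟩ := exists_sigma_iso h
      (s.ι ≫ Limits.Sigma.map fun a => terminal.from (A a))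
    obtain ⟨φ, hφ⟩ := exists_sigma_map h (i.hom ≫ s.ι) ((Category.assoc _ _ _).trans hi)
    have he : Limits.Sigma.map (fun t => φ t ≫ f t) =
        Limits.Sigma.map (fun t => φ t ≫ g t) := by
      rw [← Limits.Sigma.map_comp_map, ← Limits.Sigma.map_comp_map, ← hφ,
        Category.assoc, Category.assoc, s.condition]
    refine ⟨i.inv ≫ Limits.Sigma.map fun t =>
      Fork.IsLimit.lift (hl t).some (φ t) (sigma_map_injective h he t), ?_⟩
    rw [Category.assoc, Iso.inv_comp_eq, hφ, Limits.Sigma.map_comp_map]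
    congr 1
    funext t
    exact Fork.IsLimit.lift_ι' (hl t).some _ _
  exact ⟨H.choose, H.choose_spec, fun {m} hm =>
    (cancel_mono (Limits.Sigma.map e)).1 (hm.trans H.choose_spec.symm)⟩

/-- The family with value `X` at `j` and an initial object elsewhere. -/
noncomputable abbrev single {S : Type v} (j : S) (X : V) (s : S) : V :=
  ∐ fun _ : ULift.{v} (PLift (s = j)) => X

/-- The family of morphisms out of `single j X` induced by a morphism out of `X`. -/
noncomputable abbrev singleDesc {S : Type v} {j : S} {X : V} {A : S → V} (x : X ⟶ A j) (s : S) :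
    single j X s ⟶ A s :=
  Limits.Sigma.desc fun h => x ≫ eqToHom (by rw [h.down.down])

/-- The canonical morphism `X ⟶ single j X j`. -/
noncomputable abbrev toSingle {S : Type v} (j : S) (X : V) : X ⟶ single j X j :=
  Limits.Sigma.ι (fun _ : ULift.{v} (PLift (j = j)) => X) ⟨⟨rfl⟩⟩

lemma mono_sigma_ι {S : Type v} (h : (Phi V S).IsEquivalence) (A : S → V) (j : S) :
    Mono (Sigma.ι A j) := ⟨fun {X} x y hxy => by
  have he : Limits.Sigma.map (singleDesc (A := A) x) =
      Limits.Sigma.map (singleDesc (A := A) y) := by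
    refine Limits.Sigma.hom_ext _ _ fun s => Limits.Sigma.hom_ext _ _ fun ⟨⟨hs⟩⟩ => ?_
    subst hs
    simpa using hxy
  simpa using congrArg (toSingle j X ≫ ·) (sigma_map_injective h he j)⟩

lemma nonempty_isInitial_of_ι_eq {S : Type v} (h : (Phi V S).IsEquivalence)
    (h₀ : (Phi V PEmpty.{v + 1}).IsEquivalence) {A : S → V} {i j : S} (hij : i ≠ j) {P : V}
    (f : P ⟶ A i) (g : P ⟶ A j) (w : f ≫ Sigma.ι A i = g ≫ Sigma.ι A j) :
    Nonempty (IsInitial P) := by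
  have w' : terminal.from P ≫ Sigma.ι (fun _ : S => ⊤_ V) i =
      terminal.from P ≫ Sigma.ι (fun _ : S => ⊤_ V) j := by
    simpa using congrArg (· ≫ Limits.Sigma.map fun a => terminal.from (A a)) w
  let k : ∐ single i P ⟶ ∐ single j P := Limits.Sigma.desc fun s =>
    Limits.Sigma.desc fun _ => toSingle j P ≫ Sigma.ι (single j P) j
  obtain ⟨φ, -⟩ := exists_sigma_map h k (by
    refine Limits.Sigma.hom_ext _ _ fun s => Limits.Sigma.hom_ext _ _ fun ⟨⟨hs⟩⟩ => ?_
    subst hs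
    simpa [k] using w'.symm)
  have hI : IsInitial (single j P i) := IsInitial.ofUniqueHom
    (fun Z => Limits.Sigma.desc fun a => (hij a.down.down).elim)
    (fun Z m => Limits.Sigma.hom_ext _ _ fun a => (hij a.down.down).elim)
  exact nonempty_isInitial_of_hom h₀ hI (toSingle i P ≫ φ i)

end PhiEquivalence

/-- A bicomplete cartesian monoidal category satisfying Simpson's condition (DISJ) is
decomposing: (i) coproducts commute with decomposing equalizers, (ii) coproducts are
disjoint, and (iii) the cartesian product preserves decomposing equalizers in each
variable. -/
theorem DISJ_implies_decomposing
    (V : Type u) [Category.{v} V] [HasLimits V] [HasColimits V]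
    -- (DISJ) (a): each `Φ_S` is an equivalence
    (ha : ∀ S : Type v, (Phi V S).IsEquivalence)
    -- (DISJ) (b): the terminal object is indecomposable
    (hb : ∀ A B : V, Nonempty ((⊤_ V) ≅ A ⨿ B) →
      Nonempty (IsInitial A) ∨ Nonempty (IsInitial B))
    -- (DISJ) (c): `V` has at least two non-isomorphic objects
    (hc : ∃ A B : V, IsEmpty (A ≅ B)) :
    -- (i) coproducts commute with decomposing equalizers
    CoprodCommutesWithDecompEqualizers V ∧
    -- (ii) coproducts are disjoint
    ((∀ (S : Type v) (A : S → V) (j : S), Mono (Sigma.ι A j)) ∧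
      (∀ (S : Type v) (A : S → V) (i j : S), i ≠ j →
        Nonempty (IsInitial (pullback (Sigma.ι A i) (Sigma.ι A j))))) ∧
    -- (iii) the cartesian product preserves decomposing equalizers in each variable
    (∀ (S : Type v) (A : V) (f : A ⟶ ∐ (fun _ : S => A)), IsDecomposing f →
      ∀ (j : S) (E : V) (e : E ⟶ A)
        (hw : e ≫ f = e ≫ Sigma.ι (fun _ : S => A) j),
        Nonempty (IsLimit (Fork.ofι e hw)) → ∀ B : V,
        Nonempty (IsLimit (Fork.ofι (prod.map (𝟙 B) e)
          (show prod.map (𝟙 B) e ≫ prod.map (𝟙 B) f =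
              prod.map (𝟙 B) e ≫ prod.map (𝟙 B) (Sigma.ι (fun _ : S => A) j) by
            rw [prod.map_map, prod.map_map, hw]))) ∧
        Nonempty (IsLimit (Fork.ofι (prod.map e (𝟙 B))
          (show prod.map e (𝟙 B) ≫ prod.map f (𝟙 B) =
              prod.map e (𝟙 B) ≫ prod.map (Sigma.ι (fun _ : S => A) j) (𝟙 B) by
            rw [prod.map_map, prod.map_map, hw])))) := by
  refine ⟨?_, ⟨fun S => PhiEquivalence.mono_sigma_ι (ha S), fun S A i j hij => ?_⟩, ?_⟩
  · intro T S A f _ j E e hw hl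
    exact PhiEquivalence.nonempty_isLimit_sigma_map (ha T) f _ e hw hl _
  · exact PhiEquivalence.nonempty_isInitial_of_ι_eq (ha S) (ha _) hij _ _ pullback.condition
  · intro S A f _ j E e hw ⟨hl⟩ B
    exact ⟨nonempty_isLimit_prod_map_left hl B _,
      nonempty_isLimit_prod_map_right hl B _⟩
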